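/- Let (Z₁, Z₂) be a jointly Gaussian centered random vector in ℝ^m × ℝ^n with covariance blocks A = Cov(Z₁), B = Cov(Z₁, Z₂), C = Cov(Z₂), and assume C is invertible. Then, for (law of Z₂)-almost every y ∈ ℝ^n, the regular conditional distribution of Z₁ given Z₂ = y is the (possibly degenerate) Gaussian measure on ℝ^m with mean vector B C⁻¹ y and covariance matrix A − B C⁻¹ Bᵀ. In particular the posterior covariance does not depend on y. -/

import Mathlib

open MeasureTheory ProbabilityTheory Matrix

/-- Let `(Z₁, Z₂)` be a jointly Gaussian centered random vector in
`ℝ^m × ℝ^n` (every linear functional of the pair is centered, possibly degenerate,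
Gaussian) with covariance blocks `A = Cov(Z₁)`, `B = Cov(Z₁, Z₂)`, `C = Cov(Z₂)`, and
assume `C` is invertible.  If `κ` is a regular conditional distribution of `Z₁` given
`Z₂` (a Markov kernel disintegrating the joint law of `(Z₂, Z₁)`), then for
`(law of Z₂)`-almost every `y`, the measure `κ y` is the (possibly degenerate) Gaussian
measure on `ℝ^m` with mean vector `B C⁻¹ y` and covariance matrix `A − B C⁻¹ Bᵀ`
(characterized by its one-dimensional projections); in particular the posterior
covariance does not depend on `y`. -/
theorem gaussian_regular_conditional_distribution
    {Ω : Type*} [MeasurableSpace Ω] {P : Measure Ω} [IsProbabilityMeasure P]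
    {m n : ℕ}
    (Z₁ : Ω → Fin m → ℝ) (Z₂ : Ω → Fin n → ℝ)
    (hZ₁ : Measurable Z₁) (hZ₂ : Measurable Z₂)
    (hGauss : ∀ (a : Fin m → ℝ) (b : Fin n → ℝ), ∃ v : NNReal,
      Measure.map (fun ω => (∑ j, a j * Z₁ ω j) + ∑ r, b r * Z₂ ω r) P = gaussianReal 0 v)
    (A : Matrix (Fin m) (Fin m) ℝ) (B : Matrix (Fin m) (Fin n) ℝ)
    (C : Matrix (Fin n) (Fin n) ℝ)
    (hA : ∀ j l, A j l = ∫ ω, Z₁ ω j * Z₁ ω l ∂P)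
    (hB : ∀ j r, B j r = ∫ ω, Z₁ ω j * Z₂ ω r ∂P)
    (hC : ∀ r s, C r s = ∫ ω, Z₂ ω r * Z₂ ω s ∂P)
    (hCinv : IsUnit C.det)
    (κ : Kernel (Fin n → ℝ) (Fin m → ℝ)) [IsMarkovKernel κ]
    (hκ : Measure.map (fun ω => (Z₂ ω, Z₁ ω)) P = (Measure.map Z₂ P).compProd κ) :
    ∀ᵐ y ∂(Measure.map Z₂ P), ∀ a : Fin m → ℝ,
      Measure.map (fun z => ∑ j, a j * z j) (κ y)
        = gaussianReal (∑ j, a j * ((B * C⁻¹) *ᵥ y) j)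
            (Real.toNNReal (a ⬝ᵥ ((A - B * C⁻¹ * B.transpose) *ᵥ a))) := by
  classical
  set M : Matrix (Fin m) (Fin n) ℝ := B * C⁻¹ with hM
  have hMC : M * C = B := by
    rw [hM, Matrix.mul_assoc, Matrix.nonsing_inv_mul _ hCinv, Matrix.mul_one]
  -- joint Gaussianity
  have hJ : HasGaussianLaw (fun ω => (Z₁ ω, Z₂ ω)) P := by
    refine ⟨isGaussian_of_map_eq_gaussianReal fun L => ?_⟩
    obtain ⟨v, hv⟩ := hGauss (fun j => L (fun i => if j = i then 1 else 0, 0)) (fun r => L (0, fun i => if r = i then 1 else 0))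
    refine ⟨0, v, ?_⟩
    rw [Measure.map_map (by fun_prop) (by fun_prop), ← hv]
    congr 1
    ext ω
    have h1 : L (Z₁ ω, 0) = ∑ j, L (fun i => if j = i then 1 else 0, 0) * Z₁ ω j := by
      have := LinearMap.pi_apply_eq_sum_univ
        ((L.comp (ContinuousLinearMap.inl ℝ (Fin m → ℝ) (Fin n → ℝ))).toLinearMap) (Z₁ ω)
      simpa [mul_comm] using this
    have h2 : L (0, Z₂ ω) = ∑ r, L (0, fun i => if r = i then 1 else 0) * Z₂ ω r := by
      have := LinearMap.pi_apply_eq_sum_univ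
        ((L.comp (ContinuousLinearMap.inr ℝ (Fin m → ℝ) (Fin n → ℝ))).toLinearMap) (Z₂ ω)
      simpa [mul_comm] using this
    rw [← h1, ← h2, ← map_add]
    simp
  have hmem1 : ∀ j, MemLp (fun ω => Z₁ ω j) 2 P := fun j =>
    (hJ.map ((ContinuousLinearMap.proj j).comp
      (ContinuousLinearMap.fst ℝ (Fin m → ℝ) (Fin n → ℝ)))).memLp_two
  have hmem2 : ∀ r, MemLp (fun ω => Z₂ ω r) 2 P := fun r =>
    (hJ.map ((ContinuousLinearMap.proj r).comp
      (ContinuousLinearMap.snd ℝ (Fin m → ℝ) (Fin n → ℝ)))).memLp_two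
  have hmean : ∀ (a : Fin m → ℝ) (b : Fin n → ℝ),
      ∫ ω, ((∑ j, a j * Z₁ ω j) + ∑ r, b r * Z₂ ω r) ∂P = 0 := by
    intro a b
    obtain ⟨v, hv⟩ := hGauss a b
    have := integral_map (μ := P) (f := fun x : ℝ => x)
      (φ := fun ω => (∑ j, a j * Z₁ ω j) + ∑ r, b r * Z₂ ω r)
      (by fun_prop) (by fun_prop)
    rw [← this, hv, integral_id_gaussianReal]
  have hm1 : ∀ j, ∫ ω, Z₁ ω j ∂P = 0 := fun j => by
    simpa [Pi.single_apply] using hmean (Pi.single j 1) 0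
  have hm2 : ∀ r, ∫ ω, Z₂ ω r ∂P = 0 := fun r => by
    simpa [Pi.single_apply] using hmean 0 (Pi.single r 1)
  have cA : ∀ j l, cov[fun ω => Z₁ ω j, fun ω => Z₁ ω l; P] = A j l := fun j l => by
    rw [covariance_eq_sub (hmem1 j) (hmem1 l), hm1, hA]; simp
  have cB : ∀ j r, cov[fun ω => Z₁ ω j, fun ω => Z₂ ω r; P] = B j r := fun j r => by
    rw [covariance_eq_sub (hmem1 j) (hmem2 r), hm1, hB]; simp
  have cC : ∀ r s, cov[fun ω => Z₂ ω r, fun ω => Z₂ ω s; P] = C r s := fun r s => by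
    rw [covariance_eq_sub (hmem2 r) (hmem2 s), hm2, hC]; simp
  -- the residual
  let W : Ω → Fin m → ℝ := fun ω => Z₁ ω - M *ᵥ Z₂ ω
  have hWi : ∀ i ω, W ω i = Z₁ ω i - ∑ s, M i s * Z₂ ω s := fun i ω => rfl
  have hmulv : Measurable (fun y : Fin n → ℝ => M *ᵥ y) :=
    (Continuous.matrix_mulVec continuous_const continuous_id).measurable
  have hWm : Measurable W := hZ₁.sub (hmulv.comp hZ₂)
  have hmemMZ : ∀ i, MemLp (fun ω => ∑ s, M i s * Z₂ ω s) 2 P := fun i =>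
    memLp_finsetSum _ fun s _ => (hmem2 s).const_mul _
  have hmemW : ∀ i, MemLp (fun ω => W ω i) 2 P := fun i => (hmem1 i).sub (hmemMZ i)
  have cWZ : ∀ i r, cov[fun ω => W ω i, fun ω => Z₂ ω r; P] = 0 := fun i r => by
    simp_rw [hWi]
    rw [covariance_fun_sub_left (hmem1 i) (hmemMZ i) (hmem2 r),
      covariance_fun_sum_left (fun s => (hmem2 s).const_mul _) (hmem2 r)]
    simp_rw [covariance_const_mul_left, cC, cB]
    rw [← Matrix.mul_apply, hMC, sub_self]
  have cWA : ∀ i j, cov[fun ω => W ω i, fun ω => Z₁ ω j; P] = (A - M * B.transpose) i j :=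
    fun i j => by
    simp_rw [hWi]
    rw [covariance_fun_sub_left (hmem1 i) (hmemMZ i) (hmem1 j),
      covariance_fun_sum_left (fun s => (hmem2 s).const_mul _) (hmem1 j)]
    simp_rw [covariance_const_mul_left, covariance_comm (fun ω => Z₂ ω _), cA, cB]
    rw [Matrix.sub_apply, Matrix.mul_apply]
    rfl
  have cWW : ∀ i j, cov[fun ω => W ω i, fun ω => W ω j; P] = (A - M * B.transpose) i j :=
    fun i j => by
    have e : (fun ω => W ω j) = fun ω => Z₁ ω j - ∑ s, M j s * Z₂ ω s := rfl
    rw [e, covariance_fun_sub_right (hmemW i) (hmem1 j) (hmemMZ j),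
      covariance_fun_sum_right (fun s => (hmem2 s).const_mul _) (hmemW i)]
    simp_rw [covariance_const_mul_right, cWZ, cWA]
    simp
  -- independence
  let Φ : ((Fin m → ℝ) × (Fin n → ℝ)) →L[ℝ] ((Fin m → ℝ) × (Fin n → ℝ)) :=
    (ContinuousLinearMap.fst ℝ (Fin m → ℝ) (Fin n → ℝ) -
      (LinearMap.toContinuousLinearMap (Matrix.mulVecLin M)).comp
        (ContinuousLinearMap.snd ℝ (Fin m → ℝ) (Fin n → ℝ))).prod
      (ContinuousLinearMap.snd ℝ (Fin m → ℝ) (Fin n → ℝ))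
  have hWJ : HasGaussianLaw (fun ω => (W ω, Z₂ ω)) P := hJ.map Φ
  have hind : IndepFun W Z₂ P :=
    HasGaussianLaw.indepFun_of_covariance_eval (X := fun i ω => W ω i) (Y := fun r ω => Z₂ ω r)
      hWJ cWZ
  -- projections of the residual law
  have hproj : ∀ a : Fin m → ℝ, Measure.map (fun ω => ∑ j, a j * W ω j) P =
      gaussianReal 0 (Real.toNNReal (a ⬝ᵥ ((A - M * B.transpose) *ᵥ a))) := by
    intro a
    have hG : HasGaussianLaw (fun ω => ∑ j, a j * W ω j) P := by
      let ℓ : ((Fin m → ℝ) × (Fin n → ℝ)) →L[ℝ] ℝ :=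
        (∑ j, a j • ContinuousLinearMap.proj (R := ℝ) (φ := fun _ : Fin m => ℝ) j).comp
          (ContinuousLinearMap.fst ℝ (Fin m → ℝ) (Fin n → ℝ))
      have := hWJ.map ℓ
      convert! this using 2
      simp [ℓ]
    rw [hG.map_eq_gaussianReal]
    congr 1
    · rw [integral_finsetSum _ fun j _ =>
        ((hmemW j).const_mul _).integrable (by norm_num)]
      refine Finset.sum_eq_zero fun j _ => ?_
      rw [integral_const_mul]
      simp_rw [hWi]
      rw [integral_sub ((hmem1 j).integrable (by norm_num)) ((hmemMZ j).integrable (by norm_num)),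
        hm1, integral_finsetSum _ fun s _ => ((hmem2 s).const_mul _).integrable (by norm_num)]
      simp [integral_const_mul, hm2]
    · congr 1
      rw [← covariance_self hG.aemeasurable, covariance_fun_sum_fun_sum
        (fun j => (hmemW j).const_mul _) (fun j => (hmemW j).const_mul _)]
      simp_rw [covariance_const_mul_left, covariance_const_mul_right, cWW]
      simp only [dotProduct, Matrix.mulVec, Finset.mul_sum]
      refine Finset.sum_congr rfl fun i _ => Finset.sum_congr rfl fun j _ => by ring
  -- the explicit kernel
  have hf : Measurable (fun p : (Fin n → ℝ) × (Fin m → ℝ) => p.2 + M *ᵥ p.1) :=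
    measurable_snd.add (hmulv.comp measurable_fst)
  have htr : ∀ y, Measurable (fun w : Fin m → ℝ => w + M *ᵥ y) := fun y =>
    measurable_id.add_const _
  have : IsProbabilityMeasure (P.map W) := Measure.isProbabilityMeasure_map hWm.aemeasurable
  have : IsProbabilityMeasure (P.map Z₂) := Measure.isProbabilityMeasure_map hZ₂.aemeasurable
  let η : Kernel (Fin n → ℝ) (Fin m → ℝ) :=
    (Kernel.id ×ₖ Kernel.const _ (P.map W)).map (fun p => p.2 + M *ᵥ p.1)
  have : IsMarkovKernel η := Kernel.IsMarkovKernel.map _ hf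
  have hη : ∀ y, η y = (P.map W).map (fun w => w + M *ᵥ y) := fun y => by
    rw [Kernel.map_apply _ hf, Kernel.prod_apply, Kernel.id_apply, Kernel.const_apply,
      Measure.dirac_prod, Measure.map_map hf measurable_prodMk_left]
    rfl
  have hg : Measurable (fun p : (Fin n → ℝ) × (Fin m → ℝ) => (p.1, p.2 + M *ᵥ p.1)) :=
    measurable_fst.prodMk hf
  have hcomp : Measure.map (fun ω => (Z₂ ω, Z₁ ω)) P = (P.map Z₂).compProd η := by
    have h1 : (fun ω => (Z₂ ω, Z₁ ω)) =
        (fun p : (Fin n → ℝ) × (Fin m → ℝ) => (p.1, p.2 + M *ᵥ p.1)) ∘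
          (fun ω => (Z₂ ω, W ω)) := by
      ext ω <;> simp [W]
    rw [h1, ← Measure.map_map hg (hZ₂.prodMk hWm),
      (indepFun_iff_map_prod_eq_prod_map_map hZ₂.aemeasurable hWm.aemeasurable).1 hind.symm]
    ext s hs
    rw [Measure.map_apply hg hs, Measure.prod_apply (hg hs), Measure.compProd_apply hs]
    refine lintegral_congr fun y => ?_
    rw [hη, Measure.map_apply (htr y) (measurable_prodMk_left hs)]
    rfl
  have hae : κ =ᵐ[P.map Z₂] η := Kernel.ae_eq_of_compProd_eq (hκ.symm.trans hcomp)
  filter_upwards [hae] with y hy a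
  have hlin : Measurable (fun z : Fin m → ℝ => ∑ j, a j * z j) := by fun_prop
  rw [hy, hη, Measure.map_map (htr y) hWm, Measure.map_map hlin
    ((htr y).comp hWm)]
  have h2 : (fun z : Fin m → ℝ => ∑ j, a j * z j) ∘ (fun w => w + M *ᵥ y) ∘ W =
      (fun x => x + ∑ j, a j * (M *ᵥ y) j) ∘ (fun ω => ∑ j, a j * W ω j) := by
    ext ω
    simp [mul_add, Finset.sum_add_distrib]
  have h3 : Measurable (fun ω => ∑ j, a j * W ω j) := hlin.comp hWm
  rw [h2, ← Measure.map_map (by fun_prop) h3, hproj, gaussianReal_map_add_const,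
    zero_add]
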